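/- Under the standing assumptions, let c be a codeword of C_{n−1}(n,q) with wt(c) ≤ W(n,q), and let A := {a ∈ ℕ : there exists a line l of PG(n,q) such that exactly a points of supp(c) lie on l and a ≤ W(1,q)} (the set of sizes of thin secant lines). Then A is nonempty, its maximum m satisfies m ≤ Δ_{n,q}, and m = 0 if and only if c = 0. -/

import Mathlib

open Module

noncomputable section

/-- `pgTheta q m = 1 + q + … + q^m` for `m ≥ 0`, and `0` for `m < 0`. -/
def pgTheta (q : ℕ) (m : ℤ) : ℤ := ∑ i ∈ Finset.range (m + 1).toNat, (q : ℤ) ^ i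

/-- `q^j`, truncated to `0` for negative exponents `j`. -/
def pgQpow (q : ℕ) (j : ℤ) : ℤ := if j < 0 then 0 else (q : ℤ) ^ j.toNat

/-- `Δ_{i,q}` where `q = p^h`: `⌊√q / 2^(i-2)⌋` if `h > 2`, and `⌊p / 2^i⌋` if `h = 2`. -/
noncomputable def pgDelta (p h : ℕ) (i : ℤ) : ℤ :=
  if 2 < h then ⌊Real.sqrt ((p : ℝ) ^ h) / (2 : ℝ) ^ (i - 2)⌋
  else ⌊(p : ℝ) / (2 : ℝ) ^ i⌋

/-- `W(i,q) = (Δ_{i,q} - 1)·θ_{i-1}`. -/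
noncomputable def pgW (p h : ℕ) (i : ℤ) : ℤ := (pgDelta p h i - 1) * pgTheta (p ^ h) (i - 1)

/-- `U(n,i,q) = q^i − (Δ_{n,q} − 2)·⌊q^(i−1)⌋ − (i−2)·((q−1)·Δ_{n,q} + 1)·⌊q^(i−3)⌋ + θ_{i−3}`. -/
noncomputable def pgU (p h n : ℕ) (i : ℤ) : ℤ :=
  pgQpow (p ^ h) i - (pgDelta p h n - 2) * pgQpow (p ^ h) (i - 1)
    - (i - 2) * ((((p ^ h : ℕ) : ℤ) - 1) * pgDelta p h n + 1) * pgQpow (p ^ h) (i - 3)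
    + pgTheta (p ^ h) (i - 3)

/-- `⌈w / θ_m⌉` as a natural number. -/
noncomputable def pgCeil (q w : ℕ) (m : ℤ) : ℕ := (⌈(w : ℚ) / ((pgTheta q m : ℤ) : ℚ)⌉).toNat
open scoped Classical

/-- A point of `PG(n,q)`: a 1-dimensional subspace of `F^(n+1)`. -/
abbrev PGPoint (F : Type) [Field F] (n : ℕ) :=
  {P : Submodule F (Fin (n + 1) → F) // finrank F P = 1}

/-- The indicator function of a subspace `κ`, with values in `ZMod p`. -/
noncomputable def pgInd (p : ℕ) (F : Type) [Field F] (n : ℕ)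
    (κ : Submodule F (Fin (n + 1) → F)) : PGPoint F n → ZMod p :=
  fun P => if P.1 ≤ κ then 1 else 0

/-- The code `C_{n-1}(n,q)`: the `ZMod p`-span of the indicator functions of all
hyperplanes (i.e. `n`-dimensional subspaces of `F^(n+1)`). -/
noncomputable def pgCode (p : ℕ) (F : Type) [Field F] (n : ℕ) :
    Submodule (ZMod p) (PGPoint F n → ZMod p) :=
  Submodule.span (ZMod p)
    {f | ∃ H : Submodule F (Fin (n + 1) → F), finrank F H = n ∧ f = pgInd p F n H}

/-- The weight of a codeword: the number of points where it is nonzero. -/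
noncomputable def pgWt (p : ℕ) (F : Type) [Field F] (n : ℕ)
    (c : PGPoint F n → ZMod p) : ℕ :=
  Set.ncard {P : PGPoint F n | c P ≠ 0}

/-- The number of points of `supp c` lying in the subspace `κ`. -/
noncomputable def pgSecant (p : ℕ) (F : Type) [Field F] (n : ℕ)
    (c : PGPoint F n → ZMod p) (κ : Submodule F (Fin (n + 1) → F)) : ℕ :=
  Set.ncard {P : PGPoint F n | c P ≠ 0 ∧ P.1 ≤ κ}

/-- A codeword `c` is minimal if every codeword whose support is contained in the
support of `c` is a scalar multiple of `c`. -/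
noncomputable def pgMinimal (p : ℕ) (F : Type) [Field F] (n : ℕ)
    (c : PGPoint F n → ZMod p) : Prop :=
  ∀ c' ∈ pgCode p F n, {P : PGPoint F n | c' P ≠ 0} ⊆ {P : PGPoint F n | c P ≠ 0} →
    ∃ α : ZMod p, c' = α • c

open Polynomial

theorem natDegree_det_le_of_natDegree_le {R : Type*} [CommRing R] {s : ℕ}
    (M : Matrix (Fin s) (Fin s) R[X]) (hM : ∀ i j, (M i j).natDegree ≤ (i : ℕ) + j) :
    M.det.natDegree ≤ s * (s - 1) := by
  rw [Matrix.det_apply]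
  refine natDegree_sum_le_of_forall_le _ _ fun σ _ => ?_
  refine (natDegree_smul_le _ _).trans ?_
  refine (natDegree_prod_le _ _).trans ?_
  refine (Finset.sum_le_sum fun i _ => hM (σ i) i).trans ?_
  rw [Finset.sum_add_distrib, Equiv.sum_comp σ (fun i : Fin s => (i : ℕ)),
    Fin.sum_univ_eq_sum_range (fun i => i), ← mul_two, Finset.sum_range_id_mul_two]

theorem det_sum_pow_eq {F R : Type*} [Field F] [Fintype F] [CommRing R] [Algebra F R] {s : ℕ}
    (G : F → R) :
    (Matrix.of fun i j : Fin s => ∑ x, algebraMap F R (x ^ ((i : ℕ) + j)) * G x).det =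
      ∑ r : Fin s → F, (∏ i, algebraMap F R (r i ^ (i : ℕ)) * G (r i)) *
        algebraMap F R (Matrix.vandermonde r).det := by
  have h := (Matrix.detRowAlternating (n := Fin s) (R := R)).toMultilinearMap.map_sum
    (fun (i : Fin s) (x : F) (j : Fin s) => algebraMap F R (x ^ ((i : ℕ) + j)) * G x)
  have h1 : (Matrix.of fun i j : Fin s => ∑ x, algebraMap F R (x ^ ((i : ℕ) + j)) * G x) =
      fun i : Fin s => ∑ x : F, fun j : Fin s => algebraMap F R (x ^ ((i : ℕ) + j)) * G x := by
    ext i j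
    simp
  rw [h1]
  refine h.trans (Finset.sum_congr rfl fun r _ => ?_)
  rw [RingHom.map_det, ← Matrix.det_mul_column]
  refine congrArg Matrix.det ?_
  ext i j
  simp [Matrix.vandermonde, pow_add]
  ring

theorem X_sub_C_pow_dvd_det {F : Type*} [Field F] [Fintype F] [DecidableEq F] {s : ℕ}
    (G : F → F[X]) (y : F) :
    (X - C y) ^ (s - (Finset.univ.filter fun x => (G x).eval y ≠ 0).card) ∣
      (Matrix.of fun i j : Fin s => ∑ x, algebraMap F F[X] (x ^ ((i : ℕ) + j)) * G x).det := by
  rw [det_sum_pow_eq]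
  refine Finset.dvd_sum fun r _ => ?_
  by_cases hr : Function.Injective r
  · refine Dvd.dvd.mul_right ?_ _
    rw [Finset.prod_mul_distrib]
    refine Dvd.dvd.mul_left ?_ _
    set Z : Finset (Fin s) := Finset.univ.filter fun i => (G (r i)).eval y = 0
    have hcard : s - (Finset.univ.filter fun x => (G x).eval y ≠ 0).card ≤ Z.card := by
      have h1 : Z.card + (Finset.univ.filter fun i => ¬ (G (r i)).eval y = 0).card = s := by
        rw [Finset.card_filter_add_card_filter_not]; simp
      have h2 : (Finset.univ.filter fun i => ¬ (G (r i)).eval y = 0).card ≤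
          (Finset.univ.filter fun x => (G x).eval y ≠ 0).card :=
        Finset.card_le_card_of_injOn r (by intro i; simp) hr.injOn
      omega
    refine (pow_dvd_pow _ hcard).trans ?_
    rw [← Finset.prod_const]
    refine (Finset.prod_dvd_prod_of_dvd _ (fun i => G (r i)) fun i hi => ?_).trans
      (Finset.prod_dvd_prod_of_subset _ _ _ (Finset.subset_univ Z))
    exact dvd_iff_isRoot.2 (by simpa [Z] using hi)
  · have : (Matrix.vandermonde r).det = 0 := by
      by_contra h
      exact hr (Matrix.det_vandermonde_ne_zero_iff.1 h)
    simp [this]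

theorem det_sum_pow_ne_zero {F : Type*} [Field F] [Fintype F] {s : ℕ} (g : F → F)
    (T : Finset F) (hT : ∀ x, x ∈ T ↔ g x ≠ 0) (hs : T.card = s) :
    (Matrix.of fun i j : Fin s => ∑ x, x ^ ((i : ℕ) + j) * g x).det ≠ 0 := by
  subst hs
  let e : Fin T.card ≃ T := T.equivFin.symm
  let v : Fin T.card → F := fun i => e i
  have hv : Function.Injective v := Subtype.val_injective.comp e.injective
  have hM : (Matrix.of fun i j : Fin T.card => ∑ x, x ^ ((i : ℕ) + j) * g x) =
      (Matrix.vandermonde v).transpose * Matrix.diagonal (fun i => g (v i)) *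
        Matrix.vandermonde v := by
    ext i j
    rw [Matrix.mul_apply]
    simp only [Matrix.of_apply, Matrix.mul_diagonal, Matrix.transpose_apply,
      Matrix.vandermonde_apply]
    rw [e.sum_comp (fun x : T => (x : F) ^ (i : ℕ) * g x * (x : F) ^ (j : ℕ)),
      Finset.sum_coe_sort T (fun x => x ^ (i : ℕ) * g x * x ^ (j : ℕ)),
      ← Finset.sum_subset (Finset.subset_univ T)]
    · exact Finset.sum_congr rfl fun x _ => by ring
    · intro x _ hx
      simp [not_not.1 (mt (hT x).2 hx)]
  rw [hM, Matrix.det_mul, Matrix.det_mul, Matrix.det_transpose, Matrix.det_diagonal]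
  have h1 := Matrix.det_vandermonde_ne_zero_iff.2 hv
  exact mul_ne_zero (mul_ne_zero h1 (Finset.prod_ne_zero_iff.2 fun i _ => (hT _).1 (e i).2)) h1

theorem sum_card_sub_le {F : Type*} [Field F] [Fintype F] [DecidableEq F] (G : F → F[X])
    (hG : ∀ k < Fintype.card F - 1,
      (∑ x, algebraMap F F[X] (x ^ k) * G x).natDegree ≤ k) (y₀ : F) (s : ℕ)
    (hs : (Finset.univ.filter fun x => (G x).eval y₀ ≠ 0).card = s)
    (hsq : 2 * s < Fintype.card F + 1) :
    ∑ y, (s - (Finset.univ.filter fun x => (G x).eval y ≠ 0).card) ≤ s * (s - 1) := by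
  set M : Matrix (Fin s) (Fin s) F[X] :=
    Matrix.of fun i j : Fin s => ∑ x, algebraMap F F[X] (x ^ ((i : ℕ) + j)) * G x with hM
  have hdet : M.det ≠ 0 := by
    intro h0
    have h1 := congrArg (evalRingHom y₀) h0
    rw [RingHom.map_det, map_zero] at h1
    refine det_sum_pow_ne_zero (fun x => (G x).eval y₀) _ (by simp) hs ?_
    rw [← h1]
    refine congrArg Matrix.det ?_
    ext i j
    simp [hM, eval_finsetSum]
  have hdvd : ∏ y, (X - C y) ^ (s - (Finset.univ.filter fun x => (G x).eval y ≠ 0).card) ∣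
      M.det := by
    refine Finset.prod_dvd_of_coprime (fun a _ b _ hab => ?_) fun y _ => X_sub_C_pow_dvd_det G y
    exact (pairwise_coprime_X_sub_C Function.injective_id hab).pow
  have hdeg := natDegree_le_of_dvd hdvd hdet
  rw [natDegree_prod_of_monic _ _ fun y _ => (monic_X_sub_C y).pow _] at hdeg
  simp only [(monic_X_sub_C _).natDegree_pow, natDegree_X_sub_C, mul_one] at hdeg
  refine hdeg.trans (natDegree_det_le_of_natDegree_le M fun i j => ?_)
  exact hG _ (by have := i.2; have := j.2; omega)

theorem natDegree_sum_pow_mul_le {F : Type*} [Field F] [Fintype F] (a b d : F) {k : ℕ}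
    (hk : k < Fintype.card F - 1) :
    (∑ x : F, algebraMap F F[X] (x ^ k) *
      (1 - (C a + C d * X + C (b * x)) ^ (Fintype.card F - 1))).natDegree ≤ k := by
  set N := Fintype.card F - 1 with hN
  have hz : ∀ m < N, ∑ x : F, algebraMap F F[X] (x ^ m) = 0 := fun m hm => by
    rw [← map_sum, FiniteField.sum_pow_lt_card_sub_one F m hm, map_zero]
  clear_value N
  have h : ∑ x : F, algebraMap F F[X] (x ^ k) * (1 - (C a + C d * X + C (b * x)) ^ N) =
      - ∑ m ∈ Finset.range (N + 1), (C a + C d * X) ^ m * C (b ^ (N - m) * (N.choose m : F)) *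
        ∑ x : F, algebraMap F F[X] (x ^ (k + (N - m))) := by
    generalize C a + C d * X = A
    simp only [mul_sub, mul_one, Finset.sum_sub_distrib, hz k hk, zero_sub, add_pow,
      Finset.mul_sum]
    rw [Finset.sum_comm, neg_inj]
    refine Finset.sum_congr rfl fun m _ => Finset.sum_congr rfl fun x _ => ?_
    simp only [pow_add, ← C_eq_algebraMap, mul_pow, C_mul, C_pow, C_eq_natCast]
    ring
  rw [h, natDegree_neg]
  refine natDegree_sum_le_of_forall_le _ _ fun m hm => ?_
  by_cases hmk : m ≤ k
  · rw [← map_sum, ← C_eq_algebraMap]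
    refine (natDegree_mul_C_le _ _).trans ((natDegree_mul_C_le _ _).trans ?_)
    refine natDegree_pow_le.trans ?_
    have : (C a + C d * X).natDegree ≤ 1 := by compute_degree
    nlinarith
  · rw [hz _ (by have := Finset.mem_range.1 hm; omega)]
    simp

theorem sub_mul_le_of_forall_pencil {F V ι : Type*} [Field F] [Fintype F] [AddCommGroup V]
    [Module F V] [Fintype V] [Fintype ι] (U : Submodule F V) (t : ι → V) (ht : ∀ i, t i ∈ U)
    (S : V → Prop) (m : ℕ)
    (hm : ∀ e ∉ U, m ≤ (Finset.univ.filter fun a : ι × F => a.2 ≠ 0 ∧ S (t a.1 + a.2 • e)).card) :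
    (Fintype.card V - Fintype.card U) * m ≤
      Fintype.card ι * (Fintype.card F - 1) *
        (Finset.univ.filter fun v => v ∉ U ∧ S v).card := by
  set A : Finset V := Finset.univ.filter fun v => v ∉ U with hA
  set B : Finset (ι × F) := Finset.univ.filter fun a => a.2 ≠ 0 with hB
  have hAc : A.card = Fintype.card V - Fintype.card U := by
    have h1 : (Finset.univ.filter fun v : V => v ∈ U).card + A.card = _ :=
      Finset.card_filter_add_card_filter_not (s := (Finset.univ : Finset V)) (· ∈ U)
    have h2 : (Finset.univ.filter fun v : V => v ∈ U).card = Fintype.card U :=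
      (Fintype.card_subtype _).symm
    rw [Finset.card_univ] at h1
    omega
  have hBc : B.card = Fintype.card ι * (Fintype.card F - 1) := by
    have : B = Finset.univ ×ˢ (Finset.univ.erase (0 : F)) := by
      ext a
      simp [hB]
    rw [this, Finset.card_product, Finset.card_erase_of_mem (Finset.mem_univ _),
      Finset.card_univ, Finset.card_univ]
  have hsum := Finset.sum_card_bipartiteAbove_eq_sum_card_bipartiteBelow
    (s := A) (t := B) (fun e a => S (t a.1 + a.2 • e))
  rw [← hAc, ← hBc, ← smul_eq_mul, ← smul_eq_mul]
  refine (Finset.card_nsmul_le_sum _ _ _ fun e he => ?_).trans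
    (hsum.le.trans (Finset.sum_le_card_nsmul _ _ _ fun a ha => ?_))
  · refine (hm e (by simpa [hA] using he)).trans (le_of_eq ?_)
    rw [Finset.bipartiteAbove, hB, Finset.filter_filter]
  · have ha0 : a.2 ≠ 0 := by simpa [hB] using ha
    refine Finset.card_le_card_of_injOn (fun e => t a.1 + a.2 • e) (fun e he => ?_) ?_
    · simp only [Finset.bipartiteBelow, hA, Finset.coe_filter, Set.mem_ofPred_eq,
        Finset.mem_filter, Finset.mem_univ, true_and] at he ⊢
      rw [Submodule.add_mem_iff_right _ (ht _), Submodule.smul_mem_iff _ ha0]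
      exact he
    · intro e _ e' _ h
      exact smul_right_injective V ha0 (add_left_cancel h)

theorem card_pencil {F V : Type*} [Field F] [Fintype F] [AddCommGroup V] [Module F V]
    [Fintype V] (U : Submodule F V) {e : V} (he : e ∉ U) (S : V → Prop) :
    (Finset.univ.filter fun v => v ∈ U ⊔ Submodule.span F {e} ∧ v ∉ U ∧ S v).card =
      (Finset.univ.filter fun a : U × F => a.2 ≠ 0 ∧ S (a.1 + a.2 • e)).card := by
  symm
  refine Finset.card_bij (fun a _ => (a.1 : V) + a.2 • e) (fun a ha => ?_) ?_ ?_
  · simp only [Finset.mem_filter, Finset.mem_univ, true_and] at ha ⊢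
    refine ⟨Submodule.add_mem_sup a.1.2
      (Submodule.smul_mem _ _ (Submodule.mem_span_singleton_self e)), ?_, ha.2⟩
    rw [Submodule.add_mem_iff_right _ a.1.2, Submodule.smul_mem_iff _ ha.1]
    exact he
  · rintro ⟨a, x⟩ _ ⟨b, y⟩ _ h
    simp only at h
    have hxy : x = y := by
      by_contra hne
      have h1 : (x - y) • e = (b : V) - a := by
        rw [sub_smul, sub_eq_sub_iff_add_eq_add, add_comm, h, add_comm]
      exact he ((Submodule.smul_mem_iff U (sub_ne_zero.2 hne)).1
        (h1 ▸ U.sub_mem b.2 a.2))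
    subst hxy
    simpa using h
  · intro v hv
    simp only [Finset.mem_filter, Finset.mem_univ, true_and] at hv
    obtain ⟨a, ha, b, hb, rfl⟩ := Submodule.mem_sup.1 hv.1
    obtain ⟨y, rfl⟩ := Submodule.mem_span_singleton.1 hb
    refine ⟨(⟨a, ha⟩, y), ?_, rfl⟩
    simp only [Finset.mem_filter, Finset.mem_univ, true_and]
    refine ⟨?_, hv.2.2⟩
    rintro rfl
    exact hv.2.1 (by simpa using ha)

theorem card_eq_of_forall_mem_iff_ne_zero {F V : Type*} [Field F] [Fintype F] [AddCommGroup V]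
    [Module F V] [Fintype V] (U : Submodule F V) (s : Finset V)
    (hs : ∀ v, v ∈ s ↔ v ∈ U ∧ v ≠ 0) : s.card = Fintype.card F ^ finrank F U - 1 := by
  have h : s = (Finset.univ.filter fun v => v ∈ U).erase 0 := by
    ext v
    simp [hs, and_comm]
  rw [h, Finset.card_erase_of_mem (by simp), ← Fintype.card_subtype,
    ← Module.card_eq_pow_finrank (K := F) (V := U)]

section Points

variable {p n : ℕ} {F : Type} [Field F]

theorem PGPoint.eq_span {P : PGPoint F n} {v : Fin (n + 1) → F} (hv : v ∈ P.1) (h0 : v ≠ 0) :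
    Submodule.span F {v} = P.1 :=
  Submodule.eq_of_le_of_finrank_eq ((Submodule.span_singleton_le_iff_mem _ _).2 hv)
    ((finrank_span_singleton h0).trans P.2.symm)

/-- The nonzero vectors spanning a point of the support of `c`. -/
def pgSuppVec (c : PGPoint F n → ZMod p) (v : Fin (n + 1) → F) : Prop :=
  v ≠ 0 ∧ ∃ P : PGPoint F n, v ∈ P.1 ∧ c P ≠ 0

theorem pgSuppVec_iff {c : PGPoint F n → ZMod p} {P : PGPoint F n} {v : Fin (n + 1) → F}
    (hv : v ∈ P.1) (h0 : v ≠ 0) : pgSuppVec c v ↔ c P ≠ 0 := by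
  refine ⟨fun ⟨_, Q, hQ, hc⟩ => ?_, fun h => ⟨h0, P, hv, h⟩⟩
  rwa [Subtype.ext ((PGPoint.eq_span hv h0).symm.trans (PGPoint.eq_span hQ h0))]

theorem pgSuppVec_smul {c : PGPoint F n → ZMod p} {a : F} (ha : a ≠ 0)
    {v : Fin (n + 1) → F} : pgSuppVec c (a • v) ↔ pgSuppVec c v := by
  simp [pgSuppVec, ha, Submodule.smul_mem_iff]

theorem pgSecant_mul [Fintype F] (c : PGPoint F n → ZMod p)
    (κ : Submodule F (Fin (n + 1) → F)) :
    pgSecant p F n c κ * (Fintype.card F - 1) =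
      (Finset.univ.filter fun v => v ∈ κ ∧ pgSuppVec c v).card := by
  have := Fintype.ofFinite (PGPoint F n)
  set T : Finset (PGPoint F n) := Finset.univ.filter fun P => c P ≠ 0 ∧ P.1 ≤ κ with hT
  have h1 : pgSecant p F n c κ = T.card := by
    rw [pgSecant, ← Set.ncard_coe_finset]
    congr 1
    ext P
    simp [hT]
  have h2 : (Finset.univ.filter fun v => v ∈ κ ∧ pgSuppVec c v) =
      T.biUnion fun P => Finset.univ.filter fun v => v ∈ P.1 ∧ v ≠ 0 := by
    ext v
    simp only [Finset.mem_filter, Finset.mem_univ, true_and, Finset.mem_biUnion, hT]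
    constructor
    · rintro ⟨hv, h0, P, hP, hc⟩
      refine ⟨P, ⟨hc, ?_⟩, hP, h0⟩
      rw [← PGPoint.eq_span hP h0]
      exact (Submodule.span_singleton_le_iff_mem _ _).2 hv
    · rintro ⟨P, ⟨hc, hκ⟩, hP, h0⟩
      exact ⟨hκ hP, h0, P, hP, hc⟩
  rw [h1, h2, Finset.card_biUnion, Finset.sum_const_nat]
  · intro P _
    rw [card_eq_of_forall_mem_iff_ne_zero P.1 _ (by simp), P.2, pow_one]
  · intro P _ Q _ hPQ
    refine Finset.disjoint_left.2 ?_
    intro v hv hv'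
    simp only [Finset.mem_filter, Finset.mem_univ, true_and] at hv hv'
    exact hPQ (Subtype.ext ((PGPoint.eq_span hv.1 hv.2).symm.trans (PGPoint.eq_span hv'.1 hv'.2)))

theorem pgWt_mul [Fintype F] (c : PGPoint F n → ZMod p) :
    pgWt p F n c * (Fintype.card F - 1) = (Finset.univ.filter fun v => pgSuppVec c v).card := by
  have := pgSecant_mul c ⊤
  simpa [pgSecant, pgWt] using this

/-- Codewords are, along affine planes, given by polynomials of degree at most `q - 1`; this is
recorded through the degrees of the power sums in the first coordinate. -/
theorem exists_polynomial_of_mem_pgCode [Fintype F] [Fact p.Prime] [CharP F p]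
    {c : PGPoint F n → ZMod p} (hc : c ∈ pgCode p F n) (u w e : Fin (n + 1) → F) :
    ∃ G : F → F[X], (∀ x y (P : PGPoint F n), w + x • u + y • e ≠ 0 → w + x • u + y • e ∈ P.1 →
        (G x).eval y = ZMod.castHom (dvd_refl p) F (c P)) ∧
      ∀ k < Fintype.card F - 1, (∑ x, algebraMap F F[X] (x ^ k) * G x).natDegree ≤ k := by
  induction hc using Submodule.span_induction with
  | mem f hf =>
    obtain ⟨H, hH, rfl⟩ := hf
    obtain ⟨φ, hφ0, hφ⟩ := H.exists_le_ker_of_lt_top (lt_top_iff_ne_top.2 fun h => by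
      rw [h, finrank_top, finrank_fin_fun] at hH
      omega)
    have hker : H = LinearMap.ker φ := by
      refine Submodule.eq_of_le_of_finrank_le hφ ?_
      have := Module.Dual.finrank_ker_add_one_of_ne_zero (f := φ) hφ0
      rw [finrank_fin_fun] at this
      omega
    refine ⟨fun x => 1 - (C (φ w) + C (φ e) * X + C (φ u * x)) ^ (Fintype.card F - 1), ?_,
      fun k hk => natDegree_sum_pow_mul_le _ _ _ hk⟩
    intro x y P h0 hP
    have h1 : P.1 ≤ H ↔ φ (w + x • u + y • e) = 0 := by
      rw [← PGPoint.eq_span hP h0, Submodule.span_singleton_le_iff_mem, hker, LinearMap.mem_ker]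
    have h2 : φ w + φ e * y + φ u * x = φ (w + x • u + y • e) := by
      simp only [map_add, map_smul, smul_eq_mul]
      ring
    simp only [eval_sub, eval_one, eval_pow, eval_add, eval_mul, eval_C, eval_X, h2, pgInd, h1]
    have hq : Fintype.card F - 1 ≠ 0 := by
      have := Fintype.one_lt_card (α := F)
      omega
    split_ifs with h
    · simp [h, hq]
    · rw [FiniteField.pow_card_sub_one_eq_one _ h]
      simp
  | zero => exact ⟨0, by simp, by simp⟩
  | add f g _ _ hf hg =>
    obtain ⟨G, hG, hGd⟩ := hf
    obtain ⟨G', hG', hGd'⟩ := hg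
    refine ⟨G + G', fun x y P h0 hP => by simp [hG x y P h0 hP, hG' x y P h0 hP], fun k hk => ?_⟩
    simp only [Pi.add_apply, mul_add, Finset.sum_add_distrib]
    exact natDegree_add_le_of_degree_le (hGd k hk) (hGd' k hk)
  | smul a f _ hf =>
    obtain ⟨G, hG, hGd⟩ := hf
    refine ⟨fun x => C (ZMod.castHom (dvd_refl p) F a) * G x,
      fun x y P h0 hP => by rw [eval_mul, hG x y P h0 hP, eval_C, ← map_mul]; rfl,
      fun k hk => ?_⟩
    simp only [mul_left_comm _ (C _), ← Finset.mul_sum]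
    exact (natDegree_C_mul_le _ _).trans (hGd k hk)

end Points

section Points

variable {p n : ℕ} {F : Type} [Field F] [Fintype F]

/-- If every line through a point of the support contains at least `E` points of the support,
then the support contains at least `1 + (E - 1) * θ_{n-1}` points. -/
theorem le_pgWt_of_forall_secant {c : PGPoint F n → ZMod p} {R : PGPoint F n} (hR : c R ≠ 0)
    {E : ℕ} (hE : ∀ l : Submodule F (Fin (n + 1) → F), finrank F l = 2 → R.1 ≤ l →
      E ≤ pgSecant p F n c l) :
    (Fintype.card F ^ n - 1) * (E - 1) + (Fintype.card F - 1) ≤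
      (Fintype.card F - 1) * pgWt p F n c := by
  set q := Fintype.card F with hq
  have hq1 : 1 < q := Fintype.one_lt_card
  have hUS : ∀ v ∈ R.1, pgSuppVec c v ↔ v ≠ 0 := fun v hv =>
    ⟨fun h => h.1, fun h => (pgSuppVec_iff hv h).2 hR⟩
  have hU : ∀ s : Finset (Fin (n + 1) → F), (∀ v, v ∈ s ↔ v ∈ R.1 ∧ pgSuppVec c v) →
      s.card = q - 1 := fun s hs => by
    rw [card_eq_of_forall_mem_iff_ne_zero R.1 s fun v => (hs v).trans
      (and_congr_right fun hv => hUS v hv), R.2, pow_one]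
  have hm : ∀ e ∉ R.1, (E - 1) * (q - 1) ≤ (Finset.univ.filter fun a : R.1 × F =>
      a.2 ≠ 0 ∧ pgSuppVec c ((a.1 : Fin (n + 1) → F) + a.2 • e)).card := fun e he => by
    rw [← card_pencil R.1 he]
    set l := R.1 ⊔ Submodule.span F {e} with hl
    have hfin : finrank F l = 2 := by
      have h0 : e ≠ 0 := fun h => he (h ▸ R.1.zero_mem)
      have h1 := Submodule.finrank_sup_add_finrank_inf_eq R.1 (Submodule.span F {e})
      have h2 : R.1 ⊓ Submodule.span F {e} = ⊥ :=
        (Submodule.disjoint_span_singleton' h0).2 he |>.eq_bot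
      rw [h2, finrank_bot, R.2, finrank_span_singleton h0] at h1
      exact h1
    have h1 := Nat.mul_le_mul_right (q - 1) (hE l hfin le_sup_left)
    rw [pgSecant_mul, ← Finset.card_filter_add_card_filter_not (· ∈ R.1), Finset.filter_filter,
      Finset.filter_filter, hU _ fun v => ?_] at h1
    · rw [Nat.sub_mul, one_mul]
      refine (Nat.sub_le_sub_right h1 _).trans ?_
      rw [Nat.add_sub_cancel_left]
      exact Finset.card_le_card fun v => by simp; tauto
    · have : R.1 ≤ l := le_sup_left
      have : v ∈ R.1 → v ∈ l := fun h => this h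
      simp
      tauto
  have hmain := sub_mul_le_of_forall_pencil R.1 (fun a : R.1 => (a : Fin (n + 1) → F))
    (fun a => a.2) (pgSuppVec c) _ hm
  have hwt := pgWt_mul c
  rw [← Finset.card_filter_add_card_filter_not (· ∈ R.1), Finset.filter_filter,
    Finset.filter_filter, hU _ fun v => by simp [and_comm]] at hwt
  have hcard : Fintype.card R.1 = q := by
    rw [Module.card_eq_pow_finrank (K := F), R.2, pow_one]
  have hcard' : Fintype.card (Fin (n + 1) → F) = q ^ (n + 1) := by simp [hq]
  rw [hcard, hcard'] at hmain
  have hN : (Finset.univ.filter fun v => v ∉ R.1 ∧ pgSuppVec c v).card =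
      (Finset.univ.filter fun v => pgSuppVec c v ∧ v ∉ R.1).card := by
    congr 1
    ext v
    simp [and_comm]
  rw [hN] at hmain
  set N := (Finset.univ.filter fun v => pgSuppVec c v ∧ v ∉ R.1).card
  have h2 : (q ^ n - 1) * (E - 1) ≤ N := by
    refine Nat.le_of_mul_le_mul_left (c := q * (q - 1)) ?_ (Nat.mul_pos (by omega) (by omega))
    calc q * (q - 1) * ((q ^ n - 1) * (E - 1)) =
        (q ^ (n + 1) - q) * ((E - 1) * (q - 1)) := by
          have : q ^ (n + 1) - q = q * (q ^ n - 1) := by rw [Nat.mul_sub, pow_succ']; simp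
          rw [this]
          ring
      _ ≤ _ := hmain
  rw [mul_comm (q - 1) (pgWt p F n c), hwt]
  omega

/-- A line meeting the support of a codeword in `a < (q + 1) / 2` points forces the weight to be
at least about `a * (q - a) * q ^ (n - 2)`. -/
theorem sub_mul_le_pgWt_of_secant [Fact p.Prime] [CharP F p] {c : PGPoint F n → ZMod p}
    (hc : c ∈ pgCode p F n) {l : Submodule F (Fin (n + 1) → F)} (hl : finrank F l = 2)
    (ha : 2 * pgSecant p F n c l < Fintype.card F + 1) :
    (Fintype.card F ^ (n + 1) - Fintype.card F ^ 2) *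
        ((Fintype.card F - pgSecant p F n c l) * pgSecant p F n c l) ≤
      Fintype.card F * (Fintype.card F - 1) * ((Fintype.card F - 1) * pgWt p F n c) := by
  have hsec := pgSecant_mul c l
  set q := Fintype.card F with hq
  have hq1 : 1 < q := Fintype.one_lt_card
  set a := pgSecant p F n c l with ha_def
  obtain ⟨u, hul, hu0, huS⟩ : ∃ u ∈ l, u ≠ 0 ∧ ¬ pgSuppVec c u := by
    by_contra! h
    rw [card_eq_of_forall_mem_iff_ne_zero l _ fun v => by
      simp only [Finset.mem_filter, Finset.mem_univ, true_and]
      exact and_congr_right fun hv => ⟨fun h => h.1, h v hv⟩, hl] at hsec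
    have : q ^ 2 - 1 = (q + 1) * (q - 1) := by
      rw [← Nat.sq_sub_sq, one_pow]
    rw [this] at hsec
    have := Nat.eq_of_mul_eq_mul_right (by omega) hsec
    omega
  obtain ⟨w, hwl, hwu⟩ : ∃ w ∈ l, w ∉ Submodule.span F {u} := by
    by_contra! h
    have := Submodule.finrank_mono (show l ≤ Submodule.span F {u} from h)
    rw [finrank_span_singleton hu0, hl] at this
    omega
  have hxw : ∀ x : F, w + x • u ∉ Submodule.span F {u} := fun x hx => hwu (by
    have := Submodule.smul_mem _ x (Submodule.mem_span_singleton_self (R := F) u)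
    simpa using Submodule.sub_mem _ hx this)
  have hlspan : Submodule.span F {u} ⊔ Submodule.span F {w} = l := by
    have hw0 : w ≠ 0 := fun h => hwu (h ▸ Submodule.zero_mem _)
    refine Submodule.eq_of_le_of_finrank_eq (sup_le ?_ ?_) ?_
    · exact (Submodule.span_singleton_le_iff_mem _ _).2 hul
    · exact (Submodule.span_singleton_le_iff_mem _ _).2 hwl
    · have h1 := Submodule.finrank_sup_add_finrank_inf_eq (Submodule.span F {u})
        (Submodule.span F {w})
      rw [((Submodule.disjoint_span_singleton' hw0).2 hwu).eq_bot, finrank_bot,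
        finrank_span_singleton hu0, finrank_span_singleton hw0] at h1
      rw [hl]
      exact h1
  set T : Finset F := Finset.univ.filter fun x => pgSuppVec c (w + x • u) with hT
  have hTa : T.card = a := by
    have h1 : (T ×ˢ Finset.univ.erase (0 : F)).card =
        (Finset.univ.filter fun v => v ∈ l ∧ pgSuppVec c v).card := by
      refine Finset.card_bij (fun b _ => b.2 • (w + b.1 • u)) ?_ ?_ ?_
      · rintro ⟨x, y⟩ hb
        simp only [hT, Finset.mem_product, Finset.mem_filter, Finset.mem_univ, true_and,
          Finset.mem_erase, and_true] at hb ⊢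
        exact ⟨l.smul_mem _ (l.add_mem hwl (l.smul_mem _ hul)), (pgSuppVec_smul hb.2).2 hb.1⟩
      · rintro ⟨x, y⟩ hb ⟨x', y'⟩ hb' h
        simp only [Finset.mem_product, Finset.mem_univ, Finset.mem_erase, and_true] at hb hb' h
        have h1 : (y - y') • w = (y' * x' - y * x) • u := by
          simp only [smul_add, smul_smul] at h
          rw [sub_smul, sub_smul, sub_eq_sub_iff_add_eq_add, h, add_comm (y' • w)]
        have hy : y = y' := by
          by_contra hne
          refine hwu ((Submodule.smul_mem_iff _ (sub_ne_zero.2 hne)).1 ?_)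
          rw [h1]
          exact Submodule.smul_mem _ _ (Submodule.mem_span_singleton_self u)
        subst hy
        rw [sub_self, zero_smul, eq_comm, smul_eq_zero_iff_left hu0, ← mul_sub,
          mul_eq_zero, or_iff_right hb.2, sub_eq_zero] at h1
        rw [h1]
      · intro v hv
        simp only [Finset.mem_filter, Finset.mem_univ, true_and, ← hlspan] at hv
        obtain ⟨⟨a, ha, b, hb, rfl⟩, hS⟩ := hv.imp_left Submodule.mem_sup.1
        obtain ⟨x, rfl⟩ := Submodule.mem_span_singleton.1 ha
        obtain ⟨y, rfl⟩ := Submodule.mem_span_singleton.1 hb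
        have hy : y ≠ 0 := by
          rintro rfl
          rw [zero_smul, add_zero] at hS
          have hx : x ≠ 0 := fun h => hS.1 (by simp [h])
          exact huS ((pgSuppVec_smul hx).1 hS)
        have hv : y • (w + (y⁻¹ * x) • u) = x • u + y • w := by
          rw [smul_add, smul_smul, mul_inv_cancel_left₀ hy, add_comm (y • w)]
        refine ⟨(y⁻¹ * x, y), ?_, hv⟩
        simp only [hT, Finset.mem_product, Finset.mem_filter, Finset.mem_univ, true_and,
          Finset.mem_erase, and_true]
        exact ⟨(pgSuppVec_smul hy).1 (hv ▸ hS), hy⟩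
    rw [← hsec, Finset.card_product, Finset.card_erase_of_mem (Finset.mem_univ _),
      Finset.card_univ] at h1
    exact Nat.eq_of_mul_eq_mul_right (by omega) h1
  have hm : ∀ e ∉ l, (q - a) * a ≤ (Finset.univ.filter fun b : F × F =>
      b.2 ≠ 0 ∧ pgSuppVec c ((w + b.1 • u) + b.2 • e)).card := fun e he => by
    have hne : ∀ x y : F, w + x • u + y • e ≠ 0 := fun x y h => by
      by_cases hy : y = 0
      · rw [hy, zero_smul, add_zero] at h
        exact hxw x (h ▸ Submodule.zero_mem _)
      · refine he ((Submodule.smul_mem_iff l hy).1 ?_)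
        rw [← Submodule.add_mem_iff_right l (l.add_mem hwl (l.smul_mem x hul)), h]
        exact l.zero_mem
    obtain ⟨G, hG, hGd⟩ := exists_polynomial_of_mem_pgCode hc u w e
    have hGS : ∀ x y, (G x).eval y ≠ 0 ↔ pgSuppVec c (w + x • u + y • e) := fun x y => by
      let P : PGPoint F n := ⟨Submodule.span F {w + x • u + y • e},
        finrank_span_singleton (hne x y)⟩
      have hP : w + x • u + y • e ∈ P.1 := Submodule.mem_span_singleton_self _
      rw [pgSuppVec_iff hP (hne x y), hG x y P (hne x y) hP, _root_.map_ne_zero]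
    have hcount := sum_card_sub_le G hGd 0 a
      (by rw [← hTa, hT]; congr 1; ext x; simp [hGS]) ha
    have hsplit : (Finset.univ.filter fun b : F × F =>
        b.2 ≠ 0 ∧ pgSuppVec c ((w + b.1 • u) + b.2 • e)).card =
        ∑ y ∈ Finset.univ.erase (0 : F),
          (Finset.univ.filter fun x => (G x).eval y ≠ 0).card := by
      rw [← Finset.card_sigma]
      refine Finset.card_nbij' (fun b => ⟨b.2, b.1⟩) (fun b => (b.2, b.1)) ?_ ?_ ?_ ?_
      · intro b hb
        simpa [hGS] using hb
      · intro b hb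
        simpa [hGS] using hb
      · intro b _; rfl
      · intro b _; rfl
    rw [hsplit]
    have h1 : (q - 1) * a ≤ ∑ y ∈ Finset.univ.erase (0 : F),
        ((Finset.univ.filter fun x => (G x).eval y ≠ 0).card +
          (a - (Finset.univ.filter fun x => (G x).eval y ≠ 0).card)) := by
      rw [hq, ← Finset.card_univ, ← Finset.card_erase_of_mem (Finset.mem_univ (0 : F)),
        ← smul_eq_mul]
      exact Finset.card_nsmul_le_sum _ _ _ fun y _ => by omega
    rw [Finset.sum_add_distrib] at h1
    have h2 : ∑ y ∈ Finset.univ.erase (0 : F),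
        (a - (Finset.univ.filter fun x => (G x).eval y ≠ 0).card) ≤ a * (a - 1) :=
      (Finset.sum_le_sum_of_subset (Finset.subset_univ _)).trans hcount
    have h3 : (q - 1) * a = (q - a) * a + a * (a - 1) := by
      rcases Nat.eq_zero_or_pos a with h0 | h0
      · simp [h0]
      · rw [mul_comm a, ← add_mul]
        congr 1
        omega
    omega
  have hmain := sub_mul_le_of_forall_pencil l (fun x : F => w + x • u)
    (fun x => l.add_mem hwl (l.smul_mem x hul)) (pgSuppVec c) _ hm
  rw [Module.card_eq_pow_finrank (K := F) (V := l), hl,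
    Module.card_eq_pow_finrank (K := F) (V := Fin (n + 1) → F), finrank_fin_fun] at hmain
  refine hmain.trans (Nat.mul_le_mul_left _ ?_)
  rw [mul_comm, pgWt_mul]
  exact Finset.card_le_card fun v => by simp +contextual

end Points

/-- The inequalities between `Δ_{n,q}`, `Δ_{1,q}` and `q` that the standing assumptions give. -/
theorem pgDelta_bounds {p h n : ℕ} (hh : 2 ≤ h) (hn : 3 ≤ n)
    (hq1 : 2 < h → max 32 (2 ^ (2 * n - 4)) ≤ p ^ h)
    (hq2 : h = 2 → 2 ^ (2 * n) ≤ p ^ h) :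
    32 ≤ p ^ h ∧ 1 ≤ pgDelta p h n ∧ pgDelta p h n ≤ pgDelta p h 1 ∧
      4 * pgDelta p h n ^ 2 ≤ ((p ^ h : ℕ) : ℤ) ∧
      pgDelta p h 1 ^ 2 ≤ 4 * ((p ^ h : ℕ) : ℤ) := by
  suffices H : ∃ x : ℝ, 0 ≤ x ∧ x ^ 2 = ((p ^ h : ℕ) : ℝ) ∧ ∃ y z : ℝ, pgDelta p h n = ⌊y⌋ ∧
      pgDelta p h 1 = ⌊z⌋ ∧ 1 ≤ y ∧ y ≤ z ∧ 2 * y ≤ x ∧ z ≤ 2 * x ∧ 32 ≤ p ^ h by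
    obtain ⟨x, hx0, hx, y, z, hy, hz, h1y, hyz, hyx, hzx, h32⟩ := H
    rw [hy, hz]
    have hy1 : 1 ≤ ⌊y⌋ := Int.le_floor.2 (by simpa using h1y)
    have hyz' : ⌊y⌋ ≤ ⌊z⌋ := Int.floor_mono hyz
    have hy1R : (1 : ℝ) ≤ ⌊y⌋ := by exact_mod_cast hy1
    have hz1R : (1 : ℝ) ≤ ⌊z⌋ := by exact_mod_cast hy1.trans hyz'
    have hyf := Int.floor_le y
    have hzf := Int.floor_le z
    refine ⟨h32, hy1, hyz', ?_, ?_⟩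
    · have : (4 * (⌊y⌋ : ℝ) ^ 2) ≤ ((p ^ h : ℕ) : ℝ) := by rw [← hx]; nlinarith
      exact_mod_cast this
    · have : ((⌊z⌋ : ℝ) ^ 2) ≤ 4 * ((p ^ h : ℕ) : ℝ) := by rw [← hx]; nlinarith
      exact_mod_cast this
  rcases hh.lt_or_eq with h2 | rfl
  · have hq := hq1 h2
    obtain ⟨m, rfl⟩ : ∃ m, n = m + 2 := ⟨n - 2, by omega⟩
    have hm : (2 : ℝ) ≤ 2 ^ m := by
      calc (2 : ℝ) = 2 ^ 1 := by norm_num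
        _ ≤ 2 ^ m := pow_le_pow_right₀ (by norm_num) (by omega)
    refine ⟨√((p : ℝ) ^ h), Real.sqrt_nonneg _, by rw [Real.sq_sqrt (by positivity)]; simp,
      √((p : ℝ) ^ h) / 2 ^ m, 2 * √((p : ℝ) ^ h), ?_, ?_, ?_, ?_, ?_, le_rfl,
      (le_max_left _ _).trans hq⟩
    · rw [pgDelta, if_pos h2]
      simp
    · rw [pgDelta, if_pos h2]
      congr 1
      norm_num
      ring
    · rw [one_le_div (by positivity)]
      refine Real.le_sqrt_of_sq_le ?_
      have h3 := (le_max_right _ _).trans hq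
      rw [show 2 * (m + 2) - 4 = m * 2 by omega, pow_mul] at h3
      exact_mod_cast h3
    · have h3 := div_le_self (Real.sqrt_nonneg ((p : ℝ) ^ h)) (by linarith : (1 : ℝ) ≤ 2 ^ m)
      linarith [Real.sqrt_nonneg ((p : ℝ) ^ h)]
    · rw [← mul_div_assoc, div_le_iff₀ (by positivity), mul_comm]
      exact mul_le_mul_of_nonneg_left hm (Real.sqrt_nonneg _)
  · have hq := hq2 rfl
    have hp : 2 ^ n ≤ p := by
      rw [mul_comm, pow_mul] at hq
      exact (Nat.pow_le_pow_iff_left (by norm_num)).1 hq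
    have hpR : (2 : ℝ) ^ n ≤ p := by exact_mod_cast hp
    have hm : (8 : ℝ) ≤ 2 ^ n := by
      calc (8 : ℝ) = 2 ^ 3 := by norm_num
        _ ≤ 2 ^ n := pow_le_pow_right₀ (by norm_num) hn
    have hp0 : (0 : ℝ) ≤ p := by positivity
    have hp8 : (p : ℝ) / 2 ^ n ≤ p / 8 := div_le_div_of_nonneg_left hp0 (by norm_num) hm
    refine ⟨p, hp0, by simp, p / 2 ^ n, p / 2, by simp [pgDelta], by simp [pgDelta], ?_, ?_, ?_, ?_,
      ?_⟩
    · rwa [one_le_div (by positivity)]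
    · linarith
    · linarith
    · linarith
    · have : 8 ≤ p := by exact_mod_cast hm.trans hpR
      nlinarith

theorem sub_one_mul_pgTheta (q n : ℕ) : ((q : ℤ) - 1) * pgTheta q ((n : ℤ) - 1) = q ^ n - 1 := by
  rw [pgTheta, show ((n : ℤ) - 1 + 1).toNat = n by simp, mul_comm, geom_sum_mul]

theorem sub_one_mul_lt_of_lt_of_lt {q D E a : ℤ} (hq : 32 ≤ q) (hD : 1 ≤ D) (hDq : 4 * D ^ 2 ≤ q)
    (hEq : E ^ 2 ≤ 4 * q) (hDa : D < a) (haE : a < E) :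
    2 * a < q + 1 ∧ (q - 1) * (D - 1) < (q - a) * a := by
  have h1 : (a + 1) ^ 2 ≤ 4 * q := by nlinarith
  have h2 : 2 * a < q + 1 := by nlinarith [sq_nonneg (a - 7)]
  refine ⟨h2, ?_⟩
  by_cases h : a ^ 2 < 2 * q + a - 2
  · nlinarith
  · push Not at h
    have h3 : 2 * D ≤ a := by
      by_contra! h4
      nlinarith
    nlinarith

theorem not_mul_le_of_lt {q D K z : ℤ} (hq : 32 ≤ q) (hDq : D ≤ q)
    (hK : (q - 1) * (D - 1) < K) (hz : q ^ 2 ≤ z) :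
    ¬ q * (z - 1) * K ≤ (q - 1) * (D - 1) * (q * z - 1) := by
  intro h
  have h0 : 0 ≤ z - 1 := by nlinarith
  have h1 : q * (z - 1) * ((q - 1) * (D - 1) + 1) ≤ q * (z - 1) * K :=
    mul_le_mul_of_nonneg_left hK (mul_nonneg (by linarith) h0)
  have h2 : q * (z - 1) ≤ (q - 1) * (D - 1) * (q - 1) := by nlinarith
  have h3 : (q - 1) * (D - 1) * (q - 1) ≤ (q - 1) * (q - 1) * (q - 1) := by
    refine mul_le_mul_of_nonneg_right (mul_le_mul_of_nonneg_left (by linarith) ?_) ?_ <;> linarith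
  nlinarith

/-- Lemma: the set `A` of sizes of thin secant lines to `supp(c)` is nonempty, its
maximum `m` satisfies `m ≤ Δ_{n,q}`, and `m = 0` iff `c = 0`. -/
theorem statement_4 (p h n : ℕ) (hp : p.Prime) (hh : 2 ≤ h) (hn : 3 ≤ n)
    (hq1 : 2 < h → max 32 (2 ^ (2 * n - 4)) ≤ p ^ h)
    (hq2 : h = 2 → 2 ^ (2 * n) ≤ p ^ h)
    (F : Type) [Field F] [Fintype F] (hF : Fintype.card F = p ^ h)
    (c : PGPoint F n → ZMod p) (hc : c ∈ pgCode p F n)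
    (hwt : (pgWt p F n c : ℤ) ≤ pgW p h n) :
    let A : Set ℕ := {a | ∃ l : Submodule F (Fin (n + 1) → F),
      finrank F l = 2 ∧ pgSecant p F n c l = a ∧ (a : ℤ) ≤ pgW p h 1}
    A.Nonempty ∧ ((sSup A : ℕ) : ℤ) ≤ pgDelta p h n ∧ (sSup A = 0 ↔ c = 0) := by
  intro A
  obtain ⟨h32, hD1, hDE, hDq, hEq⟩ := pgDelta_bounds hh hn hq1 hq2
  have : Fact p.Prime := ⟨hp⟩
  have : CharP F p := charP_of_card_eq_prime_pow hF
  have hW1 : pgW p h 1 = pgDelta p h 1 - 1 := by simp [pgW, pgTheta]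
  have hwt' : (((p ^ h : ℕ) : ℤ) - 1) * pgWt p F n c ≤
      (pgDelta p h n - 1) * (((p ^ h : ℕ) : ℤ) ^ n - 1) := by
    rw [← sub_one_mul_pgTheta, mul_left_comm]
    exact mul_le_mul_of_nonneg_left hwt (by omega)
  set D := pgDelta p h n
  set E := pgDelta p h 1
  set q := p ^ h
  have hbdd : BddAbove A := ⟨(E - 1).toNat, by
    rintro a ⟨l, -, -, ha⟩
    omega⟩
  have hle : ∀ a ∈ A, (a : ℤ) ≤ D := by
    rintro a ⟨l, hl, rfl, ha⟩
    by_contra! hDa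
    obtain ⟨h1, h2⟩ := sub_one_mul_lt_of_lt_of_lt (by exact_mod_cast h32) hD1 hDq hEq hDa
      (by omega : _ < E)
    have h3 := sub_mul_le_pgWt_of_secant hc hl (by rw [hF]; omega)
    rw [hF] at h3
    obtain ⟨m, rfl⟩ : ∃ m, n = m + 1 := ⟨n - 1, by omega⟩
    refine not_mul_le_of_lt (z := (q : ℤ) ^ m) (by exact_mod_cast h32) (by nlinarith) h2
      (pow_le_pow_right₀ (by omega) (by omega)) ?_
    zify [show 1 ≤ q by omega, show pgSecant p F (m + 1) c l ≤ q by omega,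
      Nat.pow_le_pow_right (show 0 < q by omega) (show 2 ≤ m + 1 + 1 by omega)] at h3
    have h4 := mul_le_mul_of_nonneg_left hwt' (by nlinarith : (0 : ℤ) ≤ q * (q - 1))
    have hq0 : (0 : ℤ) < q := by omega
    refine le_of_mul_le_mul_left ?_ hq0
    refine le_trans (le_of_eq ?_) ((h3.trans h4).trans (le_of_eq ?_)) <;> ring
  have hthin : ∀ R : PGPoint F n, c R ≠ 0 → ∃ a ∈ A, 0 < a := by
    intro R hR
    by_contra! hA
    have h1 := le_pgWt_of_forall_secant hR (E := E.toNat) fun l hl hRl => by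
      by_contra! hlt
      have h0 : pgSecant p F n c l = 0 := Nat.le_zero.1 (hA _ ⟨l, hl, rfl, by omega⟩)
      rw [pgSecant, Set.ncard_eq_zero] at h0
      exact h0.subset (show R ∈ _ from ⟨hR, hRl⟩)
    rw [hF] at h1
    zify [show 1 ≤ q by omega, show 1 ≤ E.toNat by omega, Nat.one_le_pow n q (by omega)] at h1
    rw [Int.toNat_of_nonneg (by omega)] at h1
    have h2 : (D - 1) * ((q : ℤ) ^ n - 1) ≤ (E - 1) * ((q : ℤ) ^ n - 1) :=
      mul_le_mul_of_nonneg_right (by omega)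
        (sub_nonneg.2 (one_le_pow₀ (by omega)))
    nlinarith
  have hzero : c = 0 → A = {0} := by
    rintro rfl
    ext a
    constructor
    · rintro ⟨l, -, rfl, -⟩
      simp [pgSecant]
    · rintro rfl
      have hli := (Pi.basisFun F (Fin (n + 1))).linearIndependent.comp
        (Fin.castLE (by omega : 2 ≤ n + 1)) (Fin.castLE_injective _)
      exact ⟨_, finrank_span_eq_card hli, by simp [pgSecant], by omega⟩
  have hne : A.Nonempty := by
    by_cases h0 : c = 0
    · simp [hzero h0]
    · obtain ⟨R, hR⟩ := Function.ne_iff.1 h0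
      obtain ⟨a, ha, -⟩ := hthin R hR
      exact ⟨a, ha⟩
  refine ⟨hne, hle _ (Nat.sSup_mem hne hbdd), fun h0 => ?_, fun h0 => by simp [hzero h0]⟩
  by_contra hc0
  obtain ⟨R, hR⟩ := Function.ne_iff.1 hc0
  obtain ⟨a, ha, ha0⟩ := hthin R hR
  have := le_csSup hbdd ha
  omega
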